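/- A split of C²₆ is planar and W₆-minor-free if and only if it is isomorphic to DW₅. -/

import Mathlib

open SimpleGraph

/-- `H` is a minor of `G`: there is a family of nonempty, pairwise disjoint,
connected branch sets in `G`, one for each vertex of `H`, such that adjacent
vertices of `H` have branch sets joined by an edge of `G`. -/
def SimpleGraph.IsMinorOf {W V : Type*} (H : SimpleGraph W) (G : SimpleGraph V) : Prop :=
  ∃ φ : W → Set V,
    (∀ w, (φ w).Nonempty) ∧
    (∀ w, (G.induce (φ w)).Connected) ∧
    (Pairwise fun w₁ w₂ => Disjoint (φ w₁) (φ w₂)) ∧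
    (∀ ⦃w₁ w₂⦄, H.Adj w₁ w₂ → ∃ a ∈ φ w₁, ∃ b ∈ φ w₂, G.Adj a b)

/-- The wheel `Wₙ`: a hub (`none`) joined to every vertex of a cycle of length `n`. -/
def wheel (n : ℕ) : SimpleGraph (Option (ZMod n)) :=
  SimpleGraph.fromRel fun a b =>
    (a = none ∧ b ≠ none) ∨ (∃ i j : ZMod n, a = some i ∧ b = some j ∧ j = i + 1)

/-- The square `C²ₙ` of the `n`-cycle. -/
def cycleSq (n : ℕ) : SimpleGraph (ZMod n) :=
  SimpleGraph.fromRel fun i j => j = i + 1 ∨ j = i + 2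

/-- The double wheel `DWₙ`: a cycle of length `n` plus two nonadjacent hubs,
each joined to every vertex of the cycle. -/
def doubleWheel (n : ℕ) : SimpleGraph (ZMod n ⊕ Fin 2) :=
  SimpleGraph.fromRel fun a b =>
    match a, b with
    | .inl i, .inl j => j = i + 1
    | .inl _, .inr _ => True
    | .inr _, .inl _ => True
    | .inr _, .inr _ => False

/-- The split of a vertex `v` of `G` determined by `X, Y ⊆ N(v)`:
delete `v`, and add two new adjacent vertices (`inr 0` and `inr 1`) joined
to all vertices of `X` and of `Y` respectively. -/
def splitGraph {V : Type*} (G : SimpleGraph V) (v : V) (X Y : Set V) :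
    SimpleGraph ({u : V // u ≠ v} ⊕ Fin 2) :=
  SimpleGraph.fromRel fun a b =>
    match a, b with
    | .inl u, .inl u' => G.Adj u u'
    | .inl u, .inr i => (i = 0 ∧ (u : V) ∈ X) ∨ (i = 1 ∧ (u : V) ∈ Y)
    | .inr _, .inl _ => False
    | .inr _, .inr _ => True

/-- The side conditions on the data of a split of a vertex `v`:
`X, Y ⊆ N(v)`, `X ∪ Y = N(v)` and `|X|, |Y| ≥ 3`. -/
def IsSplitData {V : Type*} (G : SimpleGraph V) (v : V) (X Y : Set V) : Prop :=
  X ⊆ G.neighborSet v ∧ Y ⊆ G.neighborSet v ∧ X ∪ Y = G.neighborSet v ∧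
    3 ≤ X.ncard ∧ 3 ≤ Y.ncard

/-- Planarity, via Wagner's characterization: a graph is planar iff it has
no `K₅` minor and no `K₃,₃` minor. -/
def IsPlanar {V : Type*} (G : SimpleGraph V) : Prop :=
  ¬ SimpleGraph.IsMinorOf (⊤ : SimpleGraph (Fin 5)) G ∧
  ¬ SimpleGraph.IsMinorOf (completeBipartiteGraph (Fin 3) (Fin 3)) G

namespace SimpleGraph

theorem IsMinorOf.of_iso {U V W : Type*} {H : SimpleGraph U} {G : SimpleGraph V}
    {G' : SimpleGraph W} (e : G ≃g G') (h : H.IsMinorOf G) : H.IsMinorOf G' := by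
  obtain ⟨φ, hne, hconn, hdisj, hadj⟩ := h
  refine ⟨fun w => e '' φ w, fun w => (hne w).image e, fun w => ?_, fun w₁ w₂ hw => ?_,
    fun w₁ w₂ hw => ?_⟩
  · refine (hconn w).map (f := ⟨fun x => ⟨e x.1, x.1, x.2, rfl⟩, fun h => e.map_adj_iff.2 h⟩) ?_
    · rintro ⟨_, x, hx, rfl⟩
      exact ⟨⟨x, hx⟩, rfl⟩
  · exact (Set.disjoint_image_iff e.injective).2 (hdisj hw)
  · obtain ⟨a, ha, b, hb, hab⟩ := hadj hw
    exact ⟨e a, ⟨a, ha, rfl⟩, e b, ⟨b, hb, rfl⟩, e.map_adj_iff.2 hab⟩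

/-- In a minor on as many vertices as the graph itself, all branch sets are singletons. -/
theorem IsMinorOf.exists_injective_hom {W V : Type*} [Fintype W] [Fintype V]
    {H : SimpleGraph W} {G : SimpleGraph V} (hcard : Fintype.card W = Fintype.card V)
    (h : H.IsMinorOf G) : ∃ g : W → V, Function.Bijective g ∧
      ∀ ⦃w₁ w₂⦄, H.Adj w₁ w₂ → G.Adj (g w₁) (g w₂) := by
  obtain ⟨φ, hne, -, hdisj, hadj⟩ := h
  choose g hg using hne
  have huniq : ∀ {w w' a}, a ∈ φ w → a ∈ φ w' → w = w' := fun ha ha' => by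
    by_contra hw
    exact Set.disjoint_left.1 (hdisj hw) ha ha'
  have hbij : Function.Bijective g :=
    (Fintype.bijective_iff_injective_and_card g).2
      ⟨fun w w' hw => huniq (hg w) (hw ▸ hg w'), hcard⟩
  have hsing : ∀ {w a}, a ∈ φ w → a = g w := fun {w a} ha => by
    obtain ⟨w', rfl⟩ := hbij.2 a
    rw [huniq ha (hg w')]
  refine ⟨g, hbij, fun w₁ w₂ hw => ?_⟩
  obtain ⟨a, ha, b, hb, hab⟩ := hadj hw
  rwa [hsing ha, hsing hb] at hab

theorem Connected.forall_eq_or_exists_adj {V : Type*} {G : SimpleGraph V} {s : Set V}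
    (h : (G.induce s).Connected) {a : V} (ha : a ∈ s) :
    (∀ b ∈ s, b = a) ∨ ∃ b ∈ s, G.Adj a b := by
  refine or_iff_not_imp_left.2 fun hs => ?_
  push Not at hs
  obtain ⟨b, hb, hba⟩ := hs
  have : Nontrivial s := ⟨⟨b, hb⟩, ⟨a, ha⟩, by simpa using hba⟩
  obtain ⟨c, hc⟩ := h.preconnected.exists_adj_of_nontrivial ⟨a, ha⟩
  exact ⟨c, c.2, hc⟩

end SimpleGraph

/-- A labelling of the vertices of the `5`-cycle by `Option (Fin n)` whose classes are nonempty,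
contain no isolated vertex unless they are singletons, and are joined whenever `r` holds. -/
def IsCycleModel {n : ℕ} (r : Fin n → Fin n → Prop) (f : ZMod 5 → Option (Fin n)) : Prop :=
  (∀ k, ∃ i, f i = some k) ∧
  (∀ k l, r k l → ∃ i, f i = some k ∧ (f (i + 1) = some l ∨ f (i - 1) = some l)) ∧
  (∀ i k, f i = some k →
    (∀ j, f j = some k → j = i) ∨ f (i + 1) = some k ∨ f (i - 1) = some k)

instance {n : ℕ} (r : Fin n → Fin n → Prop) [DecidableRel r] : DecidablePred (IsCycleModel r) :=
  fun _ => inferInstanceAs (Decidable (_ ∧ _ ∧ _))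

theorem isCycleModel_triangle_surjective :
    ∀ f : ZMod 5 → Option (Fin 3), IsCycleModel (fun k l => k ≠ l) f → ∀ i, f i ≠ none := by
  decide +kernel

theorem isCycleModel_square_surjective :
    ∀ f : ZMod 5 → Option (Fin 4),
      IsCycleModel (fun k l => k.val % 2 ≠ l.val % 2) f → ∀ i, f i ≠ none := by
  decide +kernel

theorem not_isCycleModel_claw :
    ∀ f : ZMod 5 → Option (Fin 4), ¬ IsCycleModel (fun k l => k = 0 ∧ l ≠ 0) f := by
  decide +kernel

section DoubleWheel

theorem doubleWheel_five_adj_inl_inl (i j : ZMod 5) :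
    (doubleWheel 5).Adj (.inl i) (.inl j) ↔ i + 1 = j ∨ i - 1 = j := by
  simp only [doubleWheel, fromRel_adj, ne_eq, Sum.inl.injEq]
  revert i j; decide

theorem doubleWheel_adj_inl_inr {n : ℕ} (i : ZMod n) (j : Fin 2) :
    (doubleWheel n).Adj (.inl i) (.inr j) := by
  simp [doubleWheel]

theorem doubleWheel_not_adj_inr_inr {n : ℕ} (i j : Fin 2) :
    ¬ (doubleWheel n).Adj (.inr i) (.inr j) := by
  simp [doubleWheel]

theorem not_wheel_six_isMinorOf_doubleWheel_five : ¬ (wheel 6).IsMinorOf (doubleWheel 5) := by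
  intro h
  obtain ⟨g, hg, hadj⟩ := h.exists_injective_hom (by simp)
  have hub : ∀ a, a ≠ g none → (doubleWheel 5).Adj (g none) a := fun a ha => by
    obtain ⟨w, rfl⟩ := hg.2 a
    exact hadj (by
      have : w ≠ none := fun hw => ha (hw ▸ rfl)
      simp [wheel, this, this.symm])
  generalize g none = c at hub
  rcases c with i | i
  · have := hub (.inl (i + 2)) (by simp; decide)
    rw [doubleWheel_five_adj_inl_inl] at this
    clear hub
    revert i; decide
  · exact doubleWheel_not_adj_inr_inr i (i + 1) (hub _ (by simp))

variable {W : Type*} {H : SimpleGraph W} {φ : W → Set (ZMod 5 ⊕ Fin 2)}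

/-- Branch sets avoiding both hubs form a model in the rim of the double wheel. -/
theorem exists_isCycleModel {n : ℕ} {r : Fin n → Fin n → Prop}
    (hne : ∀ w, (φ w).Nonempty) (hconn : ∀ w, ((doubleWheel 5).induce (φ w)).Connected)
    (hdisj : Pairwise fun w₁ w₂ => Disjoint (φ w₁) (φ w₂))
    (hadj : ∀ ⦃w₁ w₂⦄, H.Adj w₁ w₂ → ∃ a ∈ φ w₁, ∃ b ∈ φ w₂, (doubleWheel 5).Adj a b)
    {j : Fin n → W} (hj : Function.Injective j) (hr : ∀ k l, r k l → H.Adj (j k) (j l))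
    (hrim : ∀ k i, .inr i ∉ φ (j k)) :
    ∃ f : ZMod 5 → Option (Fin n), IsCycleModel r f ∧ ∀ i k, f i = some k ↔ .inl i ∈ φ (j k) := by
  classical
  let f : ZMod 5 → Option (Fin n) := fun i =>
    if h : ∃ k, .inl i ∈ φ (j k) then some h.choose else none
  have hf : ∀ i k, f i = some k ↔ .inl i ∈ φ (j k) := fun i k => by
    by_cases h : ∃ k, .inl i ∈ φ (j k)
    · simp only [f, dif_pos h, Option.some.injEq]
      refine ⟨fun hk => hk ▸ h.choose_spec, fun hk => ?_⟩
      by_contra hne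
      exact Set.disjoint_left.1 (hdisj (hj.ne hne)) h.choose_spec hk
    · simp only [f, dif_neg h, reduceCtorEq, false_iff]
      exact fun hk => h ⟨k, hk⟩
  refine ⟨f, ⟨fun k => ?_, fun k l hkl => ?_, fun i k hi => ?_⟩, hf⟩
  · obtain ⟨i | i, hi⟩ := hne (j k)
    · exact ⟨i, (hf i k).2 hi⟩
    · exact (hrim k i hi).elim
  · obtain ⟨a | a, ha, b | b, hb, hab⟩ := hadj (hr k l hkl)
    · refine ⟨a, (hf a k).2 ha, ?_⟩
      rcases (doubleWheel_five_adj_inl_inl a b).1 hab with rfl | rfl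
      · exact Or.inl ((hf _ l).2 hb)
      · exact Or.inr ((hf _ l).2 hb)
    · exact (hrim l b hb).elim
    · exact (hrim k a ha).elim
    · exact (hrim k a ha).elim
  · rcases (hconn (j k)).forall_eq_or_exists_adj ((hf i k).1 hi) with h | ⟨b | b, hb, hab⟩
    · exact Or.inl fun i' hi' => Sum.inl_injective (h _ ((hf i' k).1 hi'))
    · rcases (doubleWheel_five_adj_inl_inl i b).1 hab with rfl | rfl
      · exact Or.inr (Or.inl ((hf _ k).2 hb))
      · exact Or.inr (Or.inr ((hf _ k).2 hb))
    · exact (hrim k b hb).elim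

/-- Branch sets covering the rim leave no room for two adjacent further branch sets. -/
theorem not_adj_of_rim_covered {n : ℕ}
    (hdisj : Pairwise fun w₁ w₂ => Disjoint (φ w₁) (φ w₂))
    (hadj : ∀ ⦃w₁ w₂⦄, H.Adj w₁ w₂ → ∃ a ∈ φ w₁, ∃ b ∈ φ w₂, (doubleWheel 5).Adj a b)
    {j : Fin n → W} {f : ZMod 5 → Option (Fin n)} (hf : ∀ i k, f i = some k ↔ .inl i ∈ φ (j k))
    (hcover : ∀ i, f i ≠ none) {w₁ w₂ : W} (hw₁ : ∀ k, j k ≠ w₁) (hw₂ : ∀ k, j k ≠ w₂) :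
    ¬ H.Adj w₁ w₂ := by
  have key : ∀ w, (∀ k, j k ≠ w) → ∀ i, .inl i ∉ φ w := fun w hw i hi => by
    obtain ⟨k, hk⟩ := Option.ne_none_iff_exists'.1 (hcover i)
    exact Set.disjoint_left.1 (hdisj (hw k)) ((hf i k).1 hk) hi
  intro h
  obtain ⟨a | a, ha, b | b, hb, hab⟩ := hadj h
  · exact key _ hw₁ a ha
  · exact key _ hw₁ a ha
  · exact key _ hw₂ b hb
  · exact doubleWheel_not_adj_inr_inr a b hab

/-- At most two branch sets meet the hubs. -/
theorem exists_pair_containing_hubs [Nontrivial W]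
    (hdisj : Pairwise fun w₁ w₂ => Disjoint (φ w₁) (φ w₂)) :
    ∃ w₁ w₂, w₁ ≠ w₂ ∧ ∀ w, w ≠ w₁ → w ≠ w₂ → ∀ i, .inr i ∉ φ w := by
  have key : ∀ i : Fin 2, ∃ w', ∀ w, w ≠ w' → .inr i ∉ φ w := fun i => by
    by_cases h : ∃ w', .inr i ∈ φ w'
    · obtain ⟨w', hw'⟩ := h
      exact ⟨w', fun w hw hi => Set.disjoint_left.1 (hdisj hw) hi hw'⟩
    · obtain ⟨w', -⟩ := exists_pair_ne W
      exact ⟨w', fun w _ hi => h ⟨w, hi⟩⟩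
  choose c hc using key
  by_cases h : c 0 = c 1
  · obtain ⟨w₂, hw₂⟩ := exists_ne (c 0)
    refine ⟨c 0, w₂, hw₂.symm, fun w hw _ i => hc i w ?_⟩
    fin_cases i
    · exact hw
    · exact fun h' => hw (h'.trans h.symm)
  · refine ⟨c 0, c 1, h, fun w hw₀ hw₁ i => hc i w ?_⟩
    fin_cases i
    · exact hw₀
    · exact hw₁

theorem not_top_five_isMinorOf_doubleWheel_five :
    ¬ (⊤ : SimpleGraph (Fin 5)).IsMinorOf (doubleWheel 5) := by
  rintro ⟨φ, hne, hconn, hdisj, hadj⟩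
  obtain ⟨w₁, w₂, hw, hrim⟩ := exists_pair_containing_hubs hdisj
  obtain ⟨j, hj, hj₁, hj₂⟩ : ∃ j : Fin 3 → Fin 5, Function.Injective j ∧
      (∀ k, j k ≠ w₁) ∧ ∀ k, j k ≠ w₂ := by
    clear hrim
    revert w₁ w₂; decide +kernel
  obtain ⟨f, hmodel, hf⟩ := exists_isCycleModel (r := fun k l => k ≠ l) hne hconn hdisj hadj hj
    (fun k l hkl => hj.ne hkl) fun k => hrim _ (hj₁ k) (hj₂ k)
  exact not_adj_of_rim_covered hdisj hadj hf (isCycleModel_triangle_surjective f hmodel) hj₁ hj₂ hw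

theorem completeBipartiteGraph_three_three_remove_pair (w₁ w₂ : Fin 3 ⊕ Fin 3) (hw : w₁ ≠ w₂) :
    (∃ j : Fin 4 → Fin 3 ⊕ Fin 3, Function.Injective j ∧ (∀ k, j k ≠ w₁) ∧ (∀ k, j k ≠ w₂) ∧
      ∀ k l, k = 0 ∧ l ≠ 0 → (completeBipartiteGraph (Fin 3) (Fin 3)).Adj (j k) (j l)) ∨
    ((completeBipartiteGraph (Fin 3) (Fin 3)).Adj w₁ w₂ ∧
      ∃ j : Fin 4 → Fin 3 ⊕ Fin 3, Function.Injective j ∧ (∀ k, j k ≠ w₁) ∧ (∀ k, j k ≠ w₂) ∧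
        ∀ k l, k.val % 2 ≠ l.val % 2 →
          (completeBipartiteGraph (Fin 3) (Fin 3)).Adj (j k) (j l)) := by
  simp only [completeBipartiteGraph_adj]
  rcases w₁ with a | a <;> rcases w₂ with b | b
  · obtain ⟨c, hca, hcb⟩ : ∃ c, c ≠ a ∧ c ≠ b := by
      revert a b; decide
    refine Or.inl ⟨![.inl c, .inr 0, .inr 1, .inr 2], ?_, ?_, ?_, ?_⟩ <;>
      simp [Function.Injective, Fin.forall_fin_succ, hca, hcb]
  · refine Or.inr ⟨by simp, ![.inl (a + 1), .inr (b + 1), .inl (a + 2), .inr (b + 2)],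
      ?_, ?_, ?_, ?_⟩ <;>
      simp [Function.Injective, Fin.forall_fin_succ]
  · refine Or.inr ⟨by simp, ![.inl (b + 1), .inr (a + 1), .inl (b + 2), .inr (a + 2)],
      ?_, ?_, ?_, ?_⟩ <;>
      simp [Function.Injective, Fin.forall_fin_succ]
  · obtain ⟨c, hca, hcb⟩ : ∃ c, c ≠ a ∧ c ≠ b := by
      revert a b; decide
    refine Or.inl ⟨![.inr c, .inl 0, .inl 1, .inl 2], ?_, ?_, ?_, ?_⟩ <;>
      simp [Function.Injective, Fin.forall_fin_succ, hca, hcb]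

theorem not_completeBipartiteGraph_isMinorOf_doubleWheel_five :
    ¬ (completeBipartiteGraph (Fin 3) (Fin 3)).IsMinorOf (doubleWheel 5) := by
  rintro ⟨φ, hne, hconn, hdisj, hadj⟩
  have : Nontrivial (Fin 3 ⊕ Fin 3) := ⟨.inl 0, .inr 0, Sum.inl_ne_inr⟩
  obtain ⟨w₁, w₂, hw, hrim⟩ := exists_pair_containing_hubs hdisj
  rcases completeBipartiteGraph_three_three_remove_pair w₁ w₂ hw with
    ⟨j, hj, hj₁, hj₂, hr⟩ | ⟨h, j, hj, hj₁, hj₂, hr⟩ <;>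
    obtain ⟨f, hmodel, hf⟩ := exists_isCycleModel hne hconn hdisj hadj hj hr
      fun k => hrim _ (hj₁ k) (hj₂ k)
  · exact not_isCycleModel_claw f hmodel
  · exact not_adj_of_rim_covered hdisj hadj hf (isCycleModel_square_surjective f hmodel) hj₁ hj₂ h

end DoubleWheel

section Split

theorem cycleSq_six_adj (i j : ZMod 6) : (cycleSq 6).Adj i j ↔ j ≠ i ∧ j ≠ i + 3 := by
  simp only [cycleSq, fromRel_adj]
  revert i j; decide

variable {V : Type*} {G : SimpleGraph V} {v : V} {X Y : Set V}

@[simp] theorem splitGraph_adj_inl_inl (a b : {u : V // u ≠ v}) :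
    (splitGraph G v X Y).Adj (.inl a) (.inl b) ↔ G.Adj a b := by
  simp only [splitGraph, fromRel_adj, G.adj_comm b a, or_self, ne_eq, Sum.inl.injEq,
    and_iff_right_iff_imp]
  rintro h rfl
  exact G.loopless.irrefl _ h

@[simp] theorem splitGraph_adj_inl_inr (a : {u : V // u ≠ v}) (i : Fin 2) :
    (splitGraph G v X Y).Adj (.inl a) (.inr i) ↔ i = 0 ∧ a.1 ∈ X ∨ i = 1 ∧ a.1 ∈ Y := by
  simp [splitGraph]

@[simp] theorem splitGraph_adj_inr_inl (a : {u : V // u ≠ v}) (i : Fin 2) :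
    (splitGraph G v X Y).Adj (.inr i) (.inl a) ↔ i = 0 ∧ a.1 ∈ X ∨ i = 1 ∧ a.1 ∈ Y := by
  simp [splitGraph]

@[simp] theorem splitGraph_adj_inr_inr (i j : Fin 2) :
    (splitGraph G v X Y).Adj (.inr i) (.inr j) ↔ i ≠ j := by
  simp [splitGraph]

instance : DecidableRel (cycleSq 6).Adj := fun _ _ => decidable_of_iff' _ (cycleSq_six_adj _ _)

/-- The antipodes of a triangle of the octahedron, described by adjacency. -/
theorem exists_opposite_face : ∀ v p q : ZMod 6, (cycleSq 6).Adj v p → (cycleSq 6).Adj v q →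
    (cycleSq 6).Adj p q → ∃ a b c, a ≠ v ∧ (cycleSq 6).Adj p a ∧ (cycleSq 6).Adj q a ∧
      (cycleSq 6).Adj v b ∧ (cycleSq 6).Adj a b ∧ (cycleSq 6).Adj q b ∧ b ≠ p ∧
      (cycleSq 6).Adj v c ∧ (cycleSq 6).Adj a c ∧ (cycleSq 6).Adj p c ∧ c ≠ q ∧ b ≠ c := by
  decide +kernel

theorem isMinorOf_splitGraph_of_adj {v p q : ZMod 6} {X Y : Set (ZMod 6)}
    (hp : (cycleSq 6).Adj v p) (hq : (cycleSq 6).Adj v q) (hpq : (cycleSq 6).Adj p q)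
    (hX : (cycleSq 6).neighborSet v \ X ⊆ {p}) (hY : (cycleSq 6).neighborSet v \ Y ⊆ {q}) :
    (completeBipartiteGraph (Fin 3) (Fin 3)).IsMinorOf (splitGraph (cycleSq 6) v X Y) := by
  have memX : ∀ u, u ≠ p → (cycleSq 6).Adj v u → u ∈ X := fun u hu h => by
    by_contra hux
    exact hu (hX ⟨h, hux⟩)
  have memY : ∀ u, u ≠ q → (cycleSq 6).Adj v u → u ∈ Y := fun u hu h => by
    by_contra hux
    exact hu (hY ⟨h, hux⟩)
  obtain ⟨a, b, c, hav, hpa, hqa, hvb, hab, hqb, hpb, hvc, hac, hpc, hqc, hbc⟩ :=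
    exists_opposite_face v p q hp hq hpq
  have hcp : c ≠ p := hpc.ne'
  have hbq : b ≠ q := hqb.ne'
  let G := splitGraph (cycleSq 6) v X Y
  let φ₁ : Fin 3 → Set ({u : ZMod 6 // u ≠ v} ⊕ Fin 2) :=
    ![{.inr 0}, {.inr 1}, {.inl ⟨a, hav⟩}]
  let φ₂ : Fin 3 → Set ({u : ZMod 6 // u ≠ v} ⊕ Fin 2) :=
    ![{.inl ⟨b, hvb.ne'⟩}, {.inl ⟨c, hvc.ne'⟩}, {.inl ⟨p, hp.ne'⟩, .inl ⟨q, hq.ne'⟩}]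
  have hadj : ∀ i j, ∃ x ∈ φ₁ i, ∃ y ∈ φ₂ j, G.Adj x y := by
    intro i j
    fin_cases i <;> fin_cases j <;>
      simp [φ₁, φ₂, G, memX b hpb hvb, memX c hcp hvc, memX q hpq.ne' hq, memY b hbq hvb,
        memY c hqc hvc, memY p hpq.ne hp, hab, hac, hpa.symm]
  refine ⟨Sum.elim φ₁ φ₂, ?_, ?_, ?_, ?_⟩
  · rintro (i | i) <;> fin_cases i <;> simp [φ₁, φ₂]
  · have hsing : ∀ x, (G.induce {x}).Connected := fun x => by simp
    rintro (i | i) <;> fin_cases i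
    · exact hsing _
    · exact hsing _
    · exact hsing _
    · exact hsing _
    · exact hsing _
    · exact induce_pair_connected_of_adj (by simpa using hpq)
  · have h₁ : Pairwise fun i j => Disjoint (φ₁ i) (φ₁ j) := by
      intro i j hij
      fin_cases i <;> fin_cases j <;> simp [φ₁] at hij ⊢
    have h₂ : Pairwise fun i j => Disjoint (φ₂ i) (φ₂ j) := by
      intro i j hij
      fin_cases i <;> fin_cases j <;>
        simp [φ₂, hbc, hbc.symm, hpb, hbq, hqc, hcp] at hij ⊢
    have h₁₂ : ∀ i j, Disjoint (φ₁ i) (φ₂ j) := by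
      intro i j
      fin_cases i <;> fin_cases j <;> simp [φ₁, φ₂, hab.ne, hac.ne, hpa.ne', hqa.ne']
    rintro (i | i) (j | j) hij
    · exact h₁ (fun h => hij (h ▸ rfl))
    · exact h₁₂ i j
    · exact (h₁₂ j i).symm
    · exact h₂ (fun h => hij (h ▸ rfl))
  · rintro (i | i) (j | j) hij
    · simp at hij
    · exact hadj i j
    · obtain ⟨x, hx, y, hy, hxy⟩ := hadj j i
      exact ⟨y, hy, x, hx, hxy.symm⟩
    · simp at hij

instance [DecidableRel G.Adj] [DecidablePred (· ∈ X)] [DecidablePred (· ∈ Y)] :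
    DecidableRel (splitGraph G v X Y).Adj
  | .inl _, .inl _ => decidable_of_iff' _ (splitGraph_adj_inl_inl _ _)
  | .inl _, .inr _ => decidable_of_iff' _ (splitGraph_adj_inl_inr _ _)
  | .inr _, .inl _ => decidable_of_iff' _ (splitGraph_adj_inr_inl _ _)
  | .inr _, .inr _ => decidable_of_iff' _ (splitGraph_adj_inr_inr _ _)

instance : DecidableRel (doubleWheel 5).Adj
  | .inl _, .inl _ => decidable_of_iff' _ (doubleWheel_five_adj_inl_inl _ _)
  | .inl _, .inr _ => isTrue (doubleWheel_adj_inl_inr _ _)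
  | .inr _, .inl _ => isTrue (doubleWheel_adj_inl_inr _ _).symm
  | .inr _, .inr _ => isFalse (doubleWheel_not_adj_inr_inr _ _)

/-- The candidate isomorphism from `doubleWheel 5` onto the split of `v` whose sides miss `p` and
its antipode `p + 3`; the hubs go to `q` and `q + 3`. -/
def doubleWheelToSplit (v p q : ZMod 6) (hp : p ≠ v ∧ p ≠ v + 3) (hq : q ≠ v ∧ q ≠ v + 3) :
    ZMod 5 ⊕ Fin 2 → {u : ZMod 6 // u ≠ v} ⊕ Fin 2 :=
  have antipode : ∀ u w : ZMod 6, u ≠ w + 3 → u + 3 ≠ w := by decide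
  Sum.elim
    (show Fin 5 → _ from ![.inr 0, .inr 1, .inl ⟨p, hp.1⟩,
      .inl ⟨v + 3, (show ∀ u : ZMod 6, u + 3 ≠ u by decide) v⟩, .inl ⟨p + 3, antipode p v hp.2⟩])
    ![.inl ⟨q, hq.1⟩, .inl ⟨q + 3, antipode q v hq.2⟩]

theorem doubleWheelToSplit_spec : ∀ (v p q : ZMod 6) (hp : p ≠ v ∧ p ≠ v + 3)
    (hq : q ≠ v ∧ q ≠ v + 3), (q ≠ p ∧ q ≠ p + 3) →
    (∀ a b, doubleWheelToSplit v p q hp hq a = doubleWheelToSplit v p q hp hq b → a = b) ∧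
    ∀ a b, (splitGraph (cycleSq 6) v {u | (cycleSq 6).Adj v u ∧ u ≠ p}
      {u | (cycleSq 6).Adj v u ∧ u ≠ p + 3}).Adj
        (doubleWheelToSplit v p q hp hq a) (doubleWheelToSplit v p q hp hq b) ↔
      (doubleWheel 5).Adj a b := by
  decide +kernel

theorem nonempty_splitGraph_iso_doubleWheel {v p : ZMod 6} {X Y : Set (ZMod 6)}
    (hp : (cycleSq 6).Adj v p) (hX : X = {u | (cycleSq 6).Adj v u ∧ u ≠ p})
    (hY : Y = {u | (cycleSq 6).Adj v u ∧ u ≠ p + 3}) :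
    Nonempty (splitGraph (cycleSq 6) v X Y ≃g doubleWheel 5) := by
  subst hX hY
  rw [cycleSq_six_adj] at hp
  obtain ⟨q, hq, hpq⟩ : ∃ q, (q ≠ v ∧ q ≠ v + 3) ∧ (q ≠ p ∧ q ≠ p + 3) := by
    clear hp
    revert v p; decide
  obtain ⟨hinj, hadj⟩ := doubleWheelToSplit_spec v p q hp hq hpq
  have hbij : Function.Bijective (doubleWheelToSplit v p q hp hq) :=
    (Fintype.bijective_iff_injective_and_card _).2
      ⟨fun a b => hinj a b, by simp [Fintype.card_subtype_compl]⟩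
  exact ⟨(⟨Equiv.ofBijective _ hbij, fun {a b} => hadj a b⟩ : doubleWheel 5 ≃g _).symm⟩

theorem exists_sdiff_subset_singleton {α : Type*} {s t : Set α} (hs : s.ncard = 4) (hts : t ⊆ s)
    (ht : 3 ≤ t.ncard) : ∃ p ∈ s, s \ t ⊆ {p} := by
  have hfin : s.Finite := Set.finite_of_ncard_ne_zero (by omega)
  have hcard := Set.ncard_sdiff_add_ncard_of_subset hts hfin
  rcases (s \ t).eq_empty_or_nonempty with h | ⟨p, hp⟩
  · obtain ⟨p, hp⟩ := Set.nonempty_of_ncard_ne_zero (s := s) (by omega)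
    exact ⟨p, hp, by simp [h]⟩
  · refine ⟨p, hp.1, fun u hu => ?_⟩
    exact Set.ncard_le_one (hfin.sdiff) |>.1 (by omega) u hu p hp

theorem ncard_neighborSet_cycleSq_six (v : ZMod 6) : ((cycleSq 6).neighborSet v).ncard = 4 := by
  rw [Set.ncard_eq_toFinset_card']
  revert v; decide +kernel

theorem IsSplitData.isMinorOf_or_iso {v : ZMod 6} {X Y : Set (ZMod 6)}
    (h : IsSplitData (cycleSq 6) v X Y) :
    (completeBipartiteGraph (Fin 3) (Fin 3)).IsMinorOf (splitGraph (cycleSq 6) v X Y) ∨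
      Nonempty (splitGraph (cycleSq 6) v X Y ≃g doubleWheel 5) := by
  obtain ⟨hX, hY, hXY, hX3, hY3⟩ := h
  have hN := ncard_neighborSet_cycleSq_six v
  obtain ⟨p, hp, hpX⟩ := exists_sdiff_subset_singleton hN hX hX3
  obtain ⟨q, hq, hqY⟩ := exists_sdiff_subset_singleton hN hY hY3
  have hcommon : ∀ a b, (cycleSq 6).Adj v a → (cycleSq 6).Adj v b → ¬ (cycleSq 6).Adj a b →
      ∃ c, (cycleSq 6).Adj v c ∧ (cycleSq 6).Adj a c ∧ (cycleSq 6).Adj b c := by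
    clear * -
    revert v; decide +kernel
  by_cases hpq : (cycleSq 6).Adj p q
  · exact Or.inl (isMinorOf_splitGraph_of_adj hp hq hpq hpX hqY)
  obtain ⟨c, hvc, hpc, hqc⟩ := hcommon p q hp hq hpq
  by_cases hpX' : p ∈ X
  · have hempty : (cycleSq 6).neighborSet v \ X ⊆ {c} := fun u hu =>
      (hu.2 (by rw [hpX hu]; exact hpX')).elim
    exact Or.inl (isMinorOf_splitGraph_of_adj hvc hq hqc.symm hempty hqY)
  by_cases hqY' : q ∈ Y
  · have hempty : (cycleSq 6).neighborSet v \ Y ⊆ {c} := fun u hu =>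
      (hu.2 (by rw [hqY hu]; exact hqY')).elim
    exact Or.inl (isMinorOf_splitGraph_of_adj hp hvc hpc hpX hempty)
  have hne : q ≠ p := by
    rintro rfl
    have : q ∈ X ∪ Y := hXY ▸ hq
    exact this.elim hpX' hqY'
  obtain rfl : q = p + 3 := by
    rw [cycleSq_six_adj] at hpq
    tauto
  refine Or.inr (nonempty_splitGraph_iso_doubleWheel hp ?_ ?_)
  · ext u
    refine ⟨fun hu => ⟨hX hu, fun h => hpX' (h ▸ hu)⟩, fun hu => ?_⟩
    by_contra hux
    exact hu.2 (hpX ⟨hu.1, hux⟩)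
  · ext u
    refine ⟨fun hu => ⟨hY hu, fun h => hqY' (h ▸ hu)⟩, fun hu => ?_⟩
    by_contra hux
    exact hu.2 (hqY ⟨hu.1, hux⟩)

end Split

theorem stmt18 (v : ZMod 6) (X Y : Set (ZMod 6))
    (h : IsSplitData (cycleSq 6) v X Y) :
    (IsPlanar (splitGraph (cycleSq 6) v X Y) ∧
        ¬ (wheel 6).IsMinorOf (splitGraph (cycleSq 6) v X Y)) ↔
      Nonempty (splitGraph (cycleSq 6) v X Y ≃g doubleWheel 5) := by
  refine ⟨fun hG => h.isMinorOf_or_iso.resolve_left hG.1.2, fun ⟨e⟩ => ⟨⟨fun hm => ?_, fun hm => ?_⟩,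
    fun hm => ?_⟩⟩
  · exact not_top_five_isMinorOf_doubleWheel_five (hm.of_iso e)
  · exact not_completeBipartiteGraph_isMinorOf_doubleWheel_five (hm.of_iso e)
  · exact not_wheel_six_isMinorOf_doubleWheel_five (hm.of_iso e)
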